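/- Let G be a connected graph on n vertices admitting a spanning tree T with at least L leaves, where L < n. Then the burning number of G satisfies b(G) ≤ ⌈√(4(n − L)/3)⌉ + 2. -/

import Mathlib

open SimpleGraph

/-- A graph is `k`-burnable if there is a sequence of `k` vertices `v 0, …, v (k-1)`
(`v i` being set on fire at step `i+1`) whose closed balls of radii `k-1-i` cover the graph. -/
def Burnable {V : Type*} (G : SimpleGraph V) (k : ℕ) : Prop :=
  ∃ v : Fin k → V, ∀ u : V, ∃ i : Fin k,
    G.Reachable (v i) u ∧ G.dist (v i) u ≤ k - 1 - (i : ℕ)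

/-- The burning number of a graph: the least `k` such that `G` is `k`-burnable. -/
noncomputable def burningNumber {V : Type*} (G : SimpleGraph V) : ℕ :=
  sInf {k | Burnable G k}

/-- A rooted tree presented by its parent function `par` and its depth function `dep`. -/
structure ParentTree (V : Type*) where
  root : V
  par : V → V
  dep : V → ℕ
  par_root : par root = root
  dep_root : dep root = 0
  dep_par : ∀ v, v ≠ root → dep (par v) + 1 = dep v

namespace ParentTree

variable {V : Type*} (P : ParentTree V)

/-- `v` is reached from `c` in at most `r` steps by going up from both to a common ancestor. -/
def Near (r : ℕ) (c v : V) : Prop :=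
  ∃ a b, a + b ≤ r ∧ P.par^[a] c = P.par^[b] v

theorem eq_root_of_dep_eq_zero {v : V} (h : P.dep v = 0) : v = P.root := by
  by_contra hv
  have := P.dep_par v hv
  omega

theorem dep_iterate {v : V} {n : ℕ} (h : n ≤ P.dep v) : P.dep (P.par^[n] v) + n = P.dep v := by
  induction n with
  | zero => simp
  | succ n ih =>
    have h1 := ih (by omega)
    rw [Function.iterate_succ_apply']
    have h2 : P.par^[n] v ≠ P.root := by
      intro h3
      rw [h3, P.dep_root] at h1
      omega
    have := P.dep_par _ h2
    omega

theorem iterate_add_of_eq {m n k : ℕ} {x y : V} (h : P.par^[m] x = P.par^[n] y) :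
    P.par^[k + m] x = P.par^[k + n] y := by
  rw [Function.iterate_add_apply, h, ← Function.iterate_add_apply]

/-- If the ancestor chains of `l` and `z` meet at `par^[p] l = par^[q] z`, then `z` is near
`par^[i] l` as soon as the path through the meeting point is short enough. -/
theorem near_iterate {r i p q : ℕ} {l z : V} (h : P.par^[p] l = P.par^[q] z)
    (h1 : p ≤ i → i + q ≤ r + p) (h2 : i < p → p + q ≤ r + i) : P.Near r (P.par^[i] l) z := by
  rcases le_or_gt p i with hi | hi
  · refine ⟨0, i - p + q, by have := h1 hi; omega, ?_⟩
    have := P.iterate_add_of_eq (k := i - p) h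
    rwa [Nat.sub_add_cancel hi] at this
  · refine ⟨p - i, q, by have := h2 hi; omega, ?_⟩
    rw [← Function.iterate_add_apply, Nat.sub_add_cancel hi.le, h]

theorem iterate_mem {S : Finset V} (hS : ∀ v ∈ S, P.par v ∈ S) {v : V} (hv : v ∈ S) (n : ℕ) :
    P.par^[n] v ∈ S := by
  induction n with
  | zero => exact hv
  | succ n ih => rw [Function.iterate_succ_apply']; exact hS _ ih

open Classical in
/-- The descendants of `u` inside `S`. -/
noncomputable def sub (S : Finset V) (u : V) : Finset V :=
  S.filter fun v => ∃ a, P.par^[a] v = u ∧ P.dep u + a = P.dep v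

theorem mem_sub {S : Finset V} {u v : V} :
    v ∈ P.sub S u ↔ v ∈ S ∧ ∃ a, P.par^[a] v = u ∧ P.dep u + a = P.dep v := by
  simp [sub]

theorem exists_meet {S : Finset V} (hS : ∀ v ∈ S, P.par v ∈ S) {c l z : V} {h : ℕ}
    (hl : l ∈ S) (hlc : P.par^[h] l = c) (hlh : P.dep c + h = P.dep l)
    (hz : z ∈ P.sub S c) (hzl : P.dep z ≤ P.dep l) :
    ∃ p q, P.par^[p] l = P.par^[q] z ∧ p ≤ h ∧ q ≤ p ∧ h + 1 + q ≤ (P.sub S c).card := by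
  classical
  obtain ⟨hzS, a, hza, hzd⟩ := P.mem_sub.1 hz
  have hex : ∃ q, ∃ p, p ≤ h ∧ P.par^[p] l = P.par^[q] z ∧ P.dep z + p = P.dep l + q :=
    ⟨a, h, le_rfl, by rw [hlc, hza], by omega⟩
  have hqa : Nat.find hex ≤ a :=
    Nat.find_min' hex ⟨h, le_rfl, by rw [hlc, hza], by omega⟩
  have hmin : ∀ m < Nat.find hex, _ := fun m hm => Nat.find_min hex hm
  obtain ⟨p, hp, hpe, hpd⟩ := Nat.find_spec hex
  set q := Nat.find hex with hq
  refine ⟨p, q, hpe, hp, by omega, ?_⟩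
  have c1 : ((Finset.range (h + 1)).image fun j => P.par^[j] l).card = h + 1 := by
    rw [Finset.card_image_of_injOn, Finset.card_range]
    intro i hi j hj hij
    simp only [Finset.coe_range, Set.mem_Iio] at hi hj
    have h1 := P.dep_iterate (v := l) (n := i) (by omega)
    have h2 := P.dep_iterate (v := l) (n := j) (by omega)
    simp only at hij
    rw [hij] at h1
    omega
  have c2 : ((Finset.range q).image fun j => P.par^[j] z).card = q := by
    rw [Finset.card_image_of_injOn, Finset.card_range]
    intro i hi j hj hij
    simp only [Finset.coe_range, Set.mem_Iio] at hi hj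
    have h1 := P.dep_iterate (v := z) (n := i) (by omega)
    have h2 := P.dep_iterate (v := z) (n := j) (by omega)
    simp only at hij
    rw [hij] at h1
    omega
  refine (Nat.add_le_add c1.ge c2.ge).trans ?_
  rw [← Finset.card_union_of_disjoint]
  · apply Finset.card_le_card
    intro x hx
    rw [Finset.mem_union, Finset.mem_image, Finset.mem_image] at hx
    rcases hx with ⟨j, hj, rfl⟩ | ⟨j, hj, rfl⟩
    · rw [Finset.mem_range] at hj
      have h1 := P.dep_iterate (v := l) (n := j) (by omega)
      refine P.mem_sub.2 ⟨P.iterate_mem hS hl j, h - j, ?_, by omega⟩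
      rw [← Function.iterate_add_apply, Nat.sub_add_cancel (by omega), hlc]
    · rw [Finset.mem_range] at hj
      have h1 := P.dep_iterate (v := z) (n := j) (by omega)
      refine P.mem_sub.2 ⟨P.iterate_mem hS hzS j, a - j, ?_, by omega⟩
      rw [← Function.iterate_add_apply, Nat.sub_add_cancel (by omega), hza]
  · rw [Finset.disjoint_left]
    intro x hx hx'
    rw [Finset.mem_image] at hx hx'
    obtain ⟨i, hi, rfl⟩ := hx
    obtain ⟨j, hj, hij⟩ := hx'
    rw [Finset.mem_range] at hi hj
    have h1 := P.dep_iterate (v := l) (n := i) (by omega)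
    have h2 := P.dep_iterate (v := z) (n := j) (by omega)
    rw [hij] at h2
    exact hmin j hj ⟨i, by omega, hij.symm, by omega⟩

/-- Two disjoint branches below `u` whose total size is at most `2 r + 2 y + 1` are covered by one
ball of radius `r` and one of radius `y`. -/
theorem exists_two_balls {S : Finset V} (hS : ∀ v ∈ S, P.par v ∈ S) {c₀ c₁ l₀ l₁ : V}
    {h₀ h₁ r y : ℕ} (hpar : P.par c₀ = P.par c₁)
    (hl₀ : l₀ ∈ S) (hlc₀ : P.par^[h₀] l₀ = c₀) (hlh₀ : P.dep c₀ + h₀ = P.dep l₀)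
    (hmax₀ : ∀ z ∈ P.sub S c₀, P.dep z ≤ P.dep l₀)
    (hl₁ : l₁ ∈ S) (hlc₁ : P.par^[h₁] l₁ = c₁) (hlh₁ : P.dep c₁ + h₁ = P.dep l₁)
    (hmax₁ : ∀ z ∈ P.sub S c₁, P.dep z ≤ P.dep l₁)
    (hb₀ : (P.sub S c₀).card ≤ 2 * r) (hb₁ : (P.sub S c₁).card ≤ 2 * r)
    (hr : r ≤ h₀) (hD : 2 * r + 1 ≤ (h₀ + 1) + (h₁ + 1))
    (hcard : (P.sub S c₀).card + (P.sub S c₁).card ≤ 2 * r + 2 * y + 1) :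
    ∃ x x', ∀ z, z ∈ P.sub S c₀ ∨ z ∈ P.sub S c₁ → P.Near r x z ∨ P.Near y x' z := by
  have hu : P.par^[h₀ + 1] l₀ = P.par^[h₁ + 1] l₁ := by
    rw [Function.iterate_succ_apply', Function.iterate_succ_apply', hlc₀, hlc₁, hpar]
  have m₀ := fun z hz => P.exists_meet hS hl₀ hlc₀ hlh₀ hz (hmax₀ z hz)
  have m₁ := fun z hz => P.exists_meet hS hl₁ hlc₁ hlh₁ hz (hmax₁ z hz)
  have up₀ : ∀ {p q : ℕ} {z : V}, P.par^[p] l₀ = P.par^[q] z → p ≤ h₀ →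
      P.par^[h₁ + 1] l₁ = P.par^[h₀ + 1 - p + q] z := by
    intro p q z h hp
    have := P.iterate_add_of_eq (k := h₀ + 1 - p) h
    rw [Nat.sub_add_cancel (by omega), hu] at this
    exact this
  have up₁ : ∀ {p q : ℕ} {z : V}, P.par^[p] l₁ = P.par^[q] z → p ≤ h₁ →
      P.par^[h₀ + 1] l₀ = P.par^[h₁ + 1 - p + q] z := by
    intro p q z h hp
    have := P.iterate_add_of_eq (k := h₁ + 1 - p) h
    rw [Nat.sub_add_cancel (by omega), ← hu] at this
    exact this
  by_cases hone : ∀ z, z ∈ P.sub S c₀ ∨ z ∈ P.sub S c₁ →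
      P.Near r (P.par^[r] l₀) z ∨ P.Near y (P.par^[y] l₁) z
  · exact ⟨_, _, hone⟩
  push Not at hone
  obtain ⟨w, hw, hwr, hwy⟩ := hone
  rcases hw with hw | hw
  · obtain ⟨p, q, he, hp, hq, hc⟩ := m₀ w hw
    exact absurd (P.near_iterate he (fun _ => by omega) (fun _ => by omega)) hwr
  obtain ⟨p', q', he', hp', hq', hc'⟩ := m₁ w hw
  have f1 : 2 * r + 1 ≤ (h₀ + 1) + (h₁ + 1) - p' + q' := by
    by_contra hcon
    exact hwr (P.near_iterate (up₁ he' hp') (fun _ => by omega) (fun _ => by omega))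
  have f2 : 2 * y + 1 ≤ p' + q' := by
    by_contra hcon
    exact hwy (P.near_iterate he' (fun _ => by omega) (fun _ => by omega))
  rcases le_or_gt r (h₁ + 1) with hr1 | hr1
  · refine ⟨P.par^[r] l₁, P.par^[y] l₀, ?_⟩
    rintro z (hz | hz)
    · obtain ⟨p, q, he, hp, hq, hc⟩ := m₀ z hz
      by_cases hy : p + q ≤ 2 * y
      · exact Or.inr (P.near_iterate he (fun _ => by omega) (fun _ => by omega))
      · exact Or.inl (P.near_iterate (up₀ he hp) (fun _ => by omega) (fun _ => by omega))
    · obtain ⟨p, q, he, hp, hq, hc⟩ := m₁ z hz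
      exact Or.inl (P.near_iterate he (fun _ => by omega) (fun _ => by omega))
  · refine ⟨P.par^[(h₀ + 1) + (h₁ + 1) - r] l₀, P.par^[y] l₀, ?_⟩
    rintro z (hz | hz)
    · obtain ⟨p, q, he, hp, hq, hc⟩ := m₀ z hz
      by_cases hy : p + q ≤ 2 * y
      · exact Or.inr (P.near_iterate he (fun _ => by omega) (fun _ => by omega))
      · exact Or.inl (P.near_iterate he (fun _ => by omega) (fun _ => by omega))
    · obtain ⟨p, q, he, hp, hq, hc⟩ := m₁ z hz
      exact Or.inl (P.near_iterate (up₁ he hp) (fun _ => by omega) (fun _ => by omega))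

theorem par_notMem_sub {S : Finset V} {c v : V} (hv : v ∈ S) (hvc : v ∉ P.sub S c) : P.par v ∉ P.sub S c := by
  intro h
  obtain ⟨h1, a, h2, h3⟩ := P.mem_sub.1 h
  by_cases hr : v = P.root
  · rw [hr, P.par_root, ← hr] at h
    exact hvc h
  · have := P.dep_par v hr
    exact hvc (P.mem_sub.2 ⟨hv, a + 1, by rw [Function.iterate_succ_apply, h2], by omega⟩)

theorem exists_removable [DecidableEq V] {S : Finset V} (hS : ∀ v ∈ S, P.par v ∈ S) (r : ℕ) :
    (∃ x, ∀ v ∈ S, P.Near r x v) ∨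
    (∃ B ⊆ S, (∀ v ∈ S \ B, P.par v ∈ S \ B) ∧ 6 * r ≤ 4 * B.card + 3 ∧
      ∃ x, ∀ v ∈ B, P.Near r x v) ∨
    (∃ B ⊆ S, ∃ y, (∀ v ∈ S \ B, P.par v ∈ S \ B) ∧ 2 * r + 2 * y ≤ B.card ∧ 2 * r < B.card ∧
      2 * y ≤ r ∧ ∃ x x', ∀ v ∈ B, P.Near r x v ∨ P.Near y x' v) := by
  by_cases hne : S.Nonempty
  swap
  · left
    rw [Finset.not_nonempty_iff_eq_empty] at hne
    exact ⟨P.root, by simp [hne]⟩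
  by_cases hcov : ∀ u ∈ S, ∃ x, ∀ v ∈ P.sub S u, P.Near r x v
  · left
    obtain ⟨s, hs⟩ := hne
    have hroot : ∀ v, P.par^[P.dep v] v = P.root := fun v =>
      P.eq_root_of_dep_eq_zero (by have := P.dep_iterate (v := v) le_rfl; omega)
    have hrS : P.root ∈ S := hroot s ▸ P.iterate_mem hS hs _
    obtain ⟨x, hx⟩ := hcov _ hrS
    exact ⟨x, fun v hv => hx v (P.mem_sub.2 ⟨hv, P.dep v, hroot v, by rw [P.dep_root]; omega⟩)⟩
  right
  push Not at hcov
  classical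
  obtain ⟨u, hu, humax⟩ := Finset.exists_max_image
    (S.filter fun u => ∀ x, ∃ v ∈ P.sub S u, ¬ P.Near r x v) P.dep (by
      obtain ⟨u, hu, h⟩ := hcov
      exact ⟨u, Finset.mem_filter.2 ⟨hu, h⟩⟩)
  obtain ⟨huS, hun⟩ := Finset.mem_filter.1 hu
  by_cases hbig : ∃ c ∈ S, P.dep u < P.dep c ∧ 6 * r ≤ 4 * (P.sub S c).card + 3
  · left
    obtain ⟨c, hc, hd, hb⟩ := hbig
    refine ⟨P.sub S c, fun v hv => (P.mem_sub.1 hv).1, ?_, hb, ?_⟩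
    · intro v hv
      rw [Finset.mem_sdiff] at hv ⊢
      exact ⟨hS _ hv.1, P.par_notMem_sub hv.1 hv.2⟩
    · by_contra hcon
      push Not at hcon
      have := humax c (Finset.mem_filter.2 ⟨hc, hcon⟩)
      omega
  right
  push Not at hbig
  have huu : u ∈ P.sub S u := P.mem_sub.2 ⟨huS, 0, rfl, rfl⟩
  obtain ⟨l₀, hl₀, hl₀max⟩ := Finset.exists_max_image (P.sub S u) P.dep ⟨u, huu⟩
  obtain ⟨hl₀S, a₀, ha₀, hd₀⟩ := P.mem_sub.1 hl₀
  have child : ∀ {l : V} {a : ℕ}, l ∈ S → P.par^[a + 1] l = u → P.dep u + (a + 1) = P.dep l →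
      P.par (P.par^[a] l) = u ∧ P.par^[a] l ∈ S ∧ P.dep (P.par^[a] l) = P.dep u + 1 := by
    intro l a hl h1 h2
    refine ⟨by rw [← h1, Function.iterate_succ_apply'], P.iterate_mem hS hl a, ?_⟩
    have := P.dep_iterate (v := l) (n := a) (by omega)
    omega
  have subsub : ∀ {c v : V}, P.par c = u → P.dep c = P.dep u + 1 → v ∈ P.sub S c →
      v ∈ P.sub S u := by
    intro c v h1 h2 hv
    obtain ⟨h3, a, h4, h5⟩ := P.mem_sub.1 hv
    exact P.mem_sub.2 ⟨h3, a + 1, by rw [Function.iterate_succ_apply', h4, h1], by omega⟩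
  have hra : r < a₀ := by
    by_contra hcon
    obtain ⟨v, hv, hvn⟩ := hun u
    obtain ⟨_, a, h1, h2⟩ := P.mem_sub.1 hv
    have := hl₀max v hv
    exact hvn ⟨0, a, by omega, by rw [h1]; rfl⟩
  obtain ⟨h₀, rfl⟩ : ∃ h, a₀ = h + 1 := ⟨a₀ - 1, by omega⟩
  obtain ⟨hc1, hc2, hc3⟩ := child hl₀S ha₀ hd₀
  generalize hcc : P.par^[h₀] l₀ = c₀ at hc1 hc2 hc3
  have hmax₀ : ∀ z ∈ P.sub S c₀, P.dep z ≤ P.dep l₀ := fun z hz => hl₀max z (subsub hc1 hc3 hz)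
  have hb₀ := hbig c₀ hc2 (by omega)
  have hl₀c : l₀ ∈ P.sub S c₀ := P.mem_sub.2 ⟨hl₀S, h₀, hcc, by omega⟩
  have hh₀ : h₀ + 1 ≤ (P.sub S c₀).card := by
    obtain ⟨p, q, _, _, _, h⟩ := P.exists_meet hS hl₀S hcc (by omega) hl₀c le_rfl
    omega
  obtain ⟨z, hz, hzn⟩ := hun (P.par^[r] l₀)
  obtain ⟨hzS, b, hzb, hzd⟩ := P.mem_sub.1 hz
  have hzr : 2 * r < (h₀ + 1) + b := by
    by_contra hcon
    exact hzn (P.near_iterate (ha₀.trans hzb.symm) (fun _ => by omega) (fun _ => by omega))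
  obtain ⟨b, rfl⟩ : ∃ h, b = h + 1 := ⟨b - 1, by omega⟩
  obtain ⟨hc1', hc2', hc3'⟩ := child hzS hzb hzd
  generalize hcc' : P.par^[b] z = c₁ at hc1' hc2' hc3'
  have hzc : z ∈ P.sub S c₁ := P.mem_sub.2 ⟨hzS, b, hcc', by omega⟩
  have hcne : c₀ ≠ c₁ := by
    rintro rfl
    obtain ⟨p, q, he, hp, hq, hc⟩ := P.exists_meet hS hl₀S hcc (by omega) hzc (hl₀max z hz)
    exact hzn (P.near_iterate he (fun _ => by omega) (fun _ => by omega))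
  obtain ⟨l₁, hl₁, hmax₁⟩ := Finset.exists_max_image (P.sub S c₁) P.dep ⟨z, hzc⟩
  obtain ⟨hl₁S, h₁, hlc₁, hlh₁⟩ := P.mem_sub.1 hl₁
  have hb₁ := hbig c₁ hc2' (by omega)
  have hh₁ : h₁ + 1 ≤ (P.sub S c₁).card := by
    obtain ⟨p, q, _, _, _, h⟩ := P.exists_meet hS hl₁S hlc₁ hlh₁ hl₁ le_rfl
    omega
  have hzl₁ := hmax₁ z hzc
  have hdisj : Disjoint (P.sub S c₀) (P.sub S c₁) := by
    rw [Finset.disjoint_left]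
    intro v hv hv'
    obtain ⟨_, a, h1, h2⟩ := P.mem_sub.1 hv
    obtain ⟨_, a', h1', h2'⟩ := P.mem_sub.1 hv'
    obtain rfl : a = a' := by omega
    exact hcne (h1.symm.trans h1')
  have hcard := Finset.card_union_of_disjoint hdisj
  refine ⟨P.sub S c₀ ∪ P.sub S c₁, ?_, ((P.sub S c₀ ∪ P.sub S c₁).card - 2 * r) / 2, ?_, by omega,
    by omega, by omega, ?_⟩
  · intro v hv
    rcases Finset.mem_union.1 hv with h | h <;> exact (P.mem_sub.1 h).1
  · intro v hv
    simp only [Finset.mem_sdiff, Finset.mem_union, not_or] at hv ⊢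
    exact ⟨hS _ hv.1, P.par_notMem_sub hv.1 hv.2.1,
      P.par_notMem_sub hv.1 hv.2.2⟩
  · obtain ⟨x, x', hx⟩ := P.exists_two_balls hS (r := r)
      (y := ((P.sub S c₀ ∪ P.sub S c₁).card - 2 * r) / 2) (hc1.trans hc1'.symm)
      hl₀S hcc (by omega) hmax₀ hl₁S hlc₁ hlh₁ hmax₁ (by omega) (by omega) (by omega) (by omega)
      (by omega)
    exact ⟨x, x', fun v hv => hx v (Finset.mem_union.1 hv)⟩

end ParentTree

/-- Interval version of Hall's theorem: requests `i ∈ D`, each asking for a slot at least `y i`,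
can be served by distinct slots below `R`. -/
theorem exists_slot_assignment {V : Type*} [Nonempty V] (y : ℕ → ℕ) (c : ℕ → V) (R : ℕ)
    (D : Finset ℕ) (hD : ∀ z, (D.filter fun i => z ≤ y i).card ≤ R - z) :
    ∃ f : ℕ → V, ∀ i ∈ D, ∃ r < R, y i ≤ r ∧ f r = c i := by
  induction R generalizing D with
  | zero =>
    refine ⟨fun _ => Classical.arbitrary V, fun i hi => ?_⟩
    have := hD 0
    simp at this
    simp [this] at hi
  | succ R ih =>
    by_cases hne : D.Nonempty
    swap
    · rw [Finset.not_nonempty_iff_eq_empty] at hne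
      exact ⟨fun _ => Classical.arbitrary V, by simp [hne]⟩
    obtain ⟨i, hi, hmax⟩ := Finset.exists_max_image D y hne
    obtain ⟨f, hf⟩ := ih (D.erase i) (by
      intro z
      by_cases hz : z ≤ y i
      · have h1 := hD z
        rw [Finset.filter_erase, Finset.card_erase_of_mem (by simp [hi, hz])]
        omega
      · rw [Finset.filter_false_of_mem]
        · simp
        · intro j hj
          have := hmax j (Finset.mem_of_mem_erase hj)
          omega)
    have hiR : y i ≤ R := by
      have h1 := hD (y i)
      have h2 : 0 < (D.filter fun j => y i ≤ y j).card := Finset.card_pos.2 ⟨i, by simp [hi]⟩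
      omega
    refine ⟨Function.update f R (c i), fun j hj => ?_⟩
    by_cases hji : j = i
    · subst hji
      exact ⟨R, by omega, hiR, by simp⟩
    · obtain ⟨r, hr, h1, h2⟩ := hf j (Finset.mem_erase.2 ⟨hji, hj⟩)
      exact ⟨r, by omega, h1, by rw [Function.update_of_ne (by omega), h2]⟩

theorem Finset.le_two_mul_sum_of_forall_le {R : ℕ} (D : Finset ℕ) (hD : ∀ i ∈ D, R ≤ i) :
    D.card * (2 * R + D.card) ≤ ∑ i ∈ D, (2 * i + 1) := by
  induction D using Finset.induction_on_max with
  | empty => simp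
  | insert a s ha ih =>
    have has : a ∉ s := fun h => lt_irrefl _ (ha a h)
    rw [Finset.sum_insert has, Finset.card_insert_of_notMem has]
    have h1 := ih fun i hi => hD i (Finset.mem_insert_of_mem hi)
    have h2 : s.card ≤ a - R := by
      rw [← Nat.card_Ico]
      exact Finset.card_le_card fun i hi =>
        Finset.mem_Ico.2 ⟨hD i (Finset.mem_insert_of_mem hi), ha i hi⟩
    have h3 := hD a (Finset.mem_insert_self _ _)
    have h4 : R + s.card ≤ a := by omega
    nlinarith

theorem Finset.le_sum_request_weight {R z : ℕ} {D : Finset ℕ} {y : ℕ → ℕ} (hD : ∀ i ∈ D, R ≤ i)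
    (hy : ∀ i ∈ D, z ≤ y i) :
    D.card * (2 * R + D.card + 8 * z + 2) ≤ ∑ i ∈ D, (2 * i + 8 * y i + 3) := by
  have h1 := Finset.le_two_mul_sum_of_forall_le D hD
  have h2 : D.card • (8 * z + 2) ≤ ∑ i ∈ D, (8 * y i + 2) :=
    Finset.card_nsmul_le_sum _ _ _ fun i hi => by have := hy i hi; omega
  have h3 : ∑ i ∈ D, (2 * i + 8 * y i + 3) = ∑ i ∈ D, (2 * i + 1) + ∑ i ∈ D, (8 * y i + 2) := by
    rw [← Finset.sum_add_distrib]
    exact Finset.sum_congr rfl fun i _ => by ring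
  rw [h3]
  rw [smul_eq_mul] at h2
  nlinarith

namespace ParentTree

variable {V : Type*} (P : ParentTree V)

theorem exists_cover (R : ℕ) : ∀ (S : Finset V) (D : Finset ℕ) (y : ℕ → ℕ) (c : ℕ → V),
    (∀ v ∈ S, P.par v ∈ S) → (∀ i ∈ D, R ≤ i) →
    (∀ z, (D.filter fun i => z ≤ y i).card ≤ R - z) →
    ((4 * S.card + ∑ i ∈ D, (2 * i + 8 * y i + 3) : ℕ) : ℤ) ≤ 3 * ((R : ℤ) - 1) ^ 2 →
    ∃ f : ℕ → V, (∀ v ∈ S, ∃ r < R, P.Near r (f r) v) ∧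
      ∀ i ∈ D, ∃ r < R, y i ≤ r ∧ f r = c i := by
  classical
  have : Nonempty V := ⟨P.root⟩
  induction R using Nat.strong_induction_on with
  | _ R ih =>
  intro S D y c hS hDR hall hpot
  rcases Nat.eq_zero_or_pos R with rfl | hR
  · obtain ⟨f, hf⟩ := exists_slot_assignment y c 0 D hall
    have hS0 : S.card = 0 := by
      push_cast at hpot
      have : (0 : ℤ) ≤ ∑ i ∈ D, (2 * (i : ℤ) + 8 * (y i : ℤ) + 3) :=
        Finset.sum_nonneg fun i _ => by positivity
      omega
    rw [Finset.card_eq_zero] at hS0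
    exact ⟨f, by simp [hS0], hf⟩
  by_cases htight : ∃ z < R, (D.filter fun i => z ≤ y i).card = R - z
  · obtain ⟨z, hz, hzc⟩ := htight
    have hsplit := Finset.sum_filter_add_sum_filter_not D (fun i => z ≤ y i)
      (fun i => 2 * i + 8 * y i + 3)
    have hw := Finset.le_sum_request_weight (R := R) (z := z)
      (D := D.filter fun i => z ≤ y i) (y := y)
      (fun i hi => hDR i (Finset.mem_filter.1 hi).1) (fun i hi => (Finset.mem_filter.1 hi).2)
    obtain ⟨f', hf1, hf2⟩ := ih z hz S (D.filter fun i => ¬ z ≤ y i) y c hS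
      (fun i hi => hz.le.trans (hDR i (Finset.mem_filter.1 hi).1)) (by
        intro w
        by_cases hwz : w < z
        · have h1 := hall w
          have h2 : (D.filter fun i => w ≤ y i).card =
              (D.filter fun i => z ≤ y i).card +
                ((D.filter fun i => ¬ z ≤ y i).filter fun i => w ≤ y i).card := by
            rw [← Finset.card_filter_add_card_filter_not (s := D.filter fun i => w ≤ y i)
              (fun i => z ≤ y i)]
            congr 2
            · ext i
              simp only [Finset.mem_filter]
              constructor
              · rintro ⟨⟨h1, h2⟩, h3⟩; exact ⟨h1, h3⟩
              · rintro ⟨h1, h2⟩; exact ⟨⟨h1, by omega⟩, h2⟩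
            · rw [Finset.filter_filter, Finset.filter_filter]
              ext i
              simp only [Finset.mem_filter]
              tauto
          omega
        · rw [Finset.filter_false_of_mem]
          · simp
          · intro i hi
            have := (Finset.mem_filter.1 hi).2
            omega) (by
        rw [hzc] at hw
        obtain ⟨p, rfl⟩ : ∃ p, R = z + p := ⟨R - z, by omega⟩
        rw [Nat.add_sub_cancel_left] at hw
        rw [← hsplit] at hpot
        generalize ∑ i ∈ D.filter (fun i => z ≤ y i), (2 * i + 8 * y i + 3) = W at hpot hw
        generalize ∑ i ∈ D.filter (fun i => ¬ z ≤ y i), (2 * i + 8 * y i + 3) = W' at hpot ⊢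
        zify at hw
        push_cast at hw hpot ⊢
        nlinarith)
    obtain ⟨f, hf⟩ := exists_slot_assignment y c R D hall
    refine ⟨fun r => if r < z then f' r else f r, ?_, ?_⟩
    · intro v hv
      obtain ⟨r, hr, h⟩ := hf1 v hv
      exact ⟨r, hr.trans hz, by simpa [hr] using h⟩
    · intro i hi
      by_cases hiz : z ≤ y i
      · obtain ⟨r, hr, h1, h2⟩ := hf i hi
        exact ⟨r, hr, h1, by simp only [if_neg (show ¬ r < z by omega), h2]⟩
      · obtain ⟨r, hr, h1, h2⟩ := hf2 i (Finset.mem_filter.2 ⟨hi, hiz⟩)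
        exact ⟨r, by omega, h1, by simp only [if_pos hr, h2]⟩
  push Not at htight
  obtain ⟨r, rfl⟩ : ∃ r, R = r + 1 := ⟨R - 1, by omega⟩
  have hall' : ∀ z, (D.filter fun i => z ≤ y i).card ≤ r - z := by
    intro z
    have h1 := hall z
    by_cases hz : z < r + 1
    · have := htight z hz
      omega
    · omega
  rcases P.exists_removable hS r with ⟨x, hx⟩ | ⟨B, hB, hcl, hcard, x, hx⟩ |
    ⟨B, hB, w, hcl, hcard, hlt, hwr, x, x', hx⟩
  · obtain ⟨f, hf⟩ := exists_slot_assignment y c r D hall'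
    refine ⟨Function.update f r x, fun v hv => ⟨r, by omega, by simpa using hx v hv⟩,
      fun i hi => ?_⟩
    obtain ⟨s, hs, h1, h2⟩ := hf i hi
    exact ⟨s, by omega, h1, by rw [Function.update_of_ne (by omega), h2]⟩
  · have hc := Finset.card_sdiff_add_card_eq_card hB
    obtain ⟨f, hf1, hf2⟩ := ih r (by omega) (S \ B) D y c hcl
      (fun i hi => by have := hDR i hi; omega) hall' (by
        rw [← hc] at hpot
        zify at hcard
        push_cast at hpot ⊢
        nlinarith)
    refine ⟨Function.update f r x, fun v hv => ?_, fun i hi => ?_⟩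
    · by_cases hvB : v ∈ B
      · exact ⟨r, by omega, by simpa using hx v hvB⟩
      · obtain ⟨s, hs, h⟩ := hf1 v (Finset.mem_sdiff.2 ⟨hv, hvB⟩)
        exact ⟨s, by omega, by rwa [Function.update_of_ne (by omega)]⟩
    · obtain ⟨s, hs, h1, h2⟩ := hf2 i hi
      exact ⟨s, by omega, h1, by rw [Function.update_of_ne (by omega), h2]⟩
  · have hc := Finset.card_sdiff_add_card_eq_card hB
    have hrD : r ∉ D := fun h => by have := hDR r h; omega
    have hsame : ∀ i ∈ D, Function.update y r w i = y i := fun i hi =>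
      by
      rw [Function.update_of_ne]
      rintro rfl
      exact hrD hi
    obtain ⟨f, hf1, hf2⟩ := ih r (by omega) (S \ B) (insert r D) (Function.update y r w)
      (Function.update c r x') hcl
      (by
        intro i hi
        rcases Finset.mem_insert.1 hi with rfl | hi
        · exact le_rfl
        · have := hDR i hi; omega)
      (by
        intro z
        have hfe : (D.filter fun i => z ≤ Function.update y r w i) = D.filter fun i => z ≤ y i :=
          Finset.filter_congr fun i hi => by rw [hsame i hi]
        rw [Finset.filter_insert, hfe]
        have h1 := hall' z
        split_ifs with hzw
        swap
        · exact h1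
        rw [Function.update_self] at hzw
        refine (Finset.card_insert_le _ _).trans ?_
        by_contra hcon
        have hP : (D.filter fun i => z ≤ y i).card = r - z := by omega
        have hw := Finset.le_sum_request_weight (R := r + 1) (z := z)
          (D := D.filter fun i => z ≤ y i) (y := y)
          (fun i hi => hDR i (Finset.mem_filter.1 hi).1) (fun i hi => (Finset.mem_filter.1 hi).2)
        have hle : ∑ i ∈ D.filter (fun i => z ≤ y i), (2 * i + 8 * y i + 3) ≤
            ∑ i ∈ D, (2 * i + 8 * y i + 3) :=
          Finset.sum_le_sum_of_subset (Finset.filter_subset _ _)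
        rw [hP] at hw
        obtain ⟨p, rfl⟩ : ∃ p, r = z + p := ⟨r - z, by omega⟩
        rw [Nat.add_sub_cancel_left] at hw
        have hw' := hw.trans hle
        have hzp : z ≤ p := by omega
        have hBS := Finset.card_le_card hB
        generalize ∑ i ∈ D, (2 * i + 8 * y i + 3) = W at hpot hw'
        zify at hw' hzp hlt hBS
        push_cast at hpot hw'
        have hmul : (0 : ℤ) ≤ z * (p - z) := mul_nonneg (by positivity) (by linarith)
        nlinarith)
      (by
        rw [Finset.sum_insert hrD, Function.update_self,
          Finset.sum_congr rfl fun i hi => by rw [hsame i hi]]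
        rw [← hc] at hpot
        generalize ∑ i ∈ D, (2 * i + 8 * y i + 3) = W at hpot ⊢
        zify at hcard
        push_cast at hpot ⊢
        nlinarith)
    refine ⟨Function.update f r x, fun v hv => ?_, fun i hi => ?_⟩
    · by_cases hvB : v ∈ B
      · rcases hx v hvB with h | h
        · exact ⟨r, by omega, by simpa using h⟩
        · obtain ⟨s, hs, h1, h2⟩ := hf2 r (Finset.mem_insert_self _ _)
          rw [Function.update_self] at h1 h2
          obtain ⟨a, b, hab, he⟩ := h
          refine ⟨s, by omega, a, b, by omega, ?_⟩
          rw [Function.update_of_ne (by omega), h2, he]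
      · obtain ⟨s, hs, h⟩ := hf1 v (Finset.mem_sdiff.2 ⟨hv, hvB⟩)
        exact ⟨s, by omega, by rwa [Function.update_of_ne (by omega)]⟩
    · obtain ⟨s, hs, h1, h2⟩ := hf2 i (Finset.mem_insert_of_mem hi)
      have hir : i ≠ r := fun h => hrD (h ▸ hi)
      rw [Function.update_of_ne hir] at h1 h2
      exact ⟨s, by omega, h1, by rw [Function.update_of_ne (by omega), h2]⟩

theorem dist_le_of_near {G : SimpleGraph V} (hG : G.Connected)
    (hadj : ∀ v, v ≠ P.root → G.Adj v (P.par v)) {r : ℕ} {x v : V} (h : P.Near r x v) :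
    G.dist x v ≤ r := by
  have key : ∀ n u, G.dist u (P.par^[n] u) ≤ n := by
    intro n u
    induction n with
    | zero => simp
    | succ n ih =>
      rw [Function.iterate_succ_apply']
      have h1 : G.dist (P.par^[n] u) (P.par (P.par^[n] u)) ≤ 1 := by
        by_cases hr : P.par^[n] u = P.root
        · rw [hr, P.par_root]; simp
        · exact (SimpleGraph.dist_eq_one_iff_adj.2 (hadj _ hr)).le
      exact hG.dist_triangle.trans (Nat.add_le_add ih h1)
  obtain ⟨a, b, hab, he⟩ := h
  have h1 := key a x
  have h2 := key b v
  rw [he] at h1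
  rw [SimpleGraph.dist_comm] at h2
  exact hG.dist_triangle.trans ((Nat.add_le_add h1 h2).trans hab)

end ParentTree

theorem SimpleGraph.Connected.exists_parentTree {V : Type*} {T : SimpleGraph V}
    (hT : T.Connected) (ρ : V) :
    ∃ P : ParentTree V, P.root = ρ ∧ ∀ v, v ≠ P.root → T.Adj v (P.par v) := by
  classical
  have hex : ∀ v, v ≠ ρ → ∃ w, T.Adj v w ∧ T.dist ρ w + 1 = T.dist ρ v := by
    intro v hv
    obtain ⟨p, hp⟩ := hT.exists_walk_length_eq_dist v ρ
    cases p with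
    | nil => exact absurd rfl hv
    | @cons _ w _ hadj q =>
      refine ⟨w, hadj, ?_⟩
      rw [SimpleGraph.Walk.length_cons] at hp
      have h1 := SimpleGraph.dist_le q
      have h2 := hT.dist_triangle (u := v) (v := w) (w := ρ)
      rw [SimpleGraph.dist_eq_one_iff_adj.2 hadj] at h2
      rw [SimpleGraph.dist_comm, SimpleGraph.dist_comm (u := ρ) (v := v)]
      omega
  choose! f hf using hex
  refine ⟨⟨ρ, fun v => if v = ρ then ρ else f v, T.dist ρ, by simp, by simp, ?_⟩, rfl, ?_⟩
  · intro v hv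
    simp only [if_neg hv]
    exact (hf v hv).2
  · intro v hv
    simp only [if_neg hv]
    exact (hf v hv).1

theorem SimpleGraph.Connected.exists_parentTree_card_le {V : Type*} [Fintype V] [DecidableEq V]
    {T : SimpleGraph V} [DecidableRel T.Adj] (hT : T.Connected) (L : ℕ)
    (hL : L ≤ (Finset.univ.filter fun v : V => T.degree v = 1).card) (hLn : L < Fintype.card V) :
    ∃ P : ParentTree V, (∀ v, v ≠ P.root → T.Adj v (P.par v)) ∧
      (Finset.univ.image P.par).card + L ≤ Fintype.card V := by
  have key : ∀ P : ParentTree V, (∀ v, v ≠ P.root → T.Adj v (P.par v)) →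
      ∀ v, v ≠ P.root → T.degree v = 1 → v ∉ Finset.univ.image P.par := by
    intro P hP v hv hd hmem
    obtain ⟨w, -, rfl⟩ := Finset.mem_image.1 hmem
    have hw : w ≠ P.root := by
      rintro rfl
      exact hv P.par_root
    have h1 := P.dep_par _ hw
    have h2 := P.dep_par _ hv
    obtain ⟨a, ha⟩ := Finset.card_eq_one.1 hd
    have h3 : w ∈ T.neighborFinset (P.par w) := by simpa using (hP w hw).symm
    have h4 : P.par (P.par w) ∈ T.neighborFinset (P.par w) := by simpa using hP _ hv
    rw [ha, Finset.mem_singleton] at h3 h4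
    rw [h4, ← h3] at h2
    omega
  by_cases hroot : ∃ ρ, T.degree ρ ≠ 1
  · obtain ⟨ρ, hρ⟩ := hroot
    obtain ⟨P, rfl, hP⟩ := hT.exists_parentTree ρ
    refine ⟨P, hP, (Nat.add_le_add_left hL _).trans ?_⟩
    rw [← Finset.card_union_of_disjoint]
    · exact Finset.card_le_univ _
    · rw [Finset.disjoint_right]
      intro v hv
      have hd := (Finset.mem_filter.1 hv).2
      exact key P hP v (fun h => hρ (h ▸ hd)) hd
  · push Not at hroot
    obtain ⟨ρ⟩ := hT.nonempty
    obtain ⟨P, rfl, hP⟩ := hT.exists_parentTree ρ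
    refine ⟨P, hP, ?_⟩
    have hsub : Finset.univ.image P.par ⊆ {P.root} := by
      intro v hv
      rw [Finset.mem_singleton]
      by_contra hne
      exact key P hP v hne (hroot v) hv
    have := Finset.card_le_card hsub
    rw [Finset.card_singleton] at this
    omega

theorem burning_of_many_leaves {V : Type*} [Fintype V] (G T : SimpleGraph V)
    [DecidableRel T.Adj] (hG : G.Connected) (hT : T.IsTree) (hle : T ≤ G)
    (L : ℕ) (hL : L ≤ (Finset.univ.filter fun v : V => T.degree v = 1).card)
    (hLn : L < Fintype.card V) :
    burningNumber G ≤ ⌈Real.sqrt (4 * ((Fintype.card V : ℝ) - L) / 3)⌉₊ + 2 := by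
  classical
  obtain ⟨P, hP, hcard⟩ := hT.connected.exists_parentTree_card_le L hL hLn
  set m := ⌈Real.sqrt (4 * ((Fintype.card V : ℝ) - L) / 3)⌉₊ with hm
  have hsq : 4 * ((Fintype.card V : ℝ) - L) ≤ 3 * (m : ℝ) ^ 2 := by
    have h1 : 4 * ((Fintype.card V : ℝ) - L) / 3 ≤ (m : ℝ) ^ 2 :=
      (Real.sqrt_le_left (by positivity)).1 (Nat.le_ceil _)
    linarith
  have hpot : 4 * (Finset.univ.image P.par).card ≤ 3 * m ^ 2 := by
    have h1 : ((Finset.univ.image P.par).card : ℝ) + L ≤ Fintype.card V := by exact_mod_cast hcard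
    have h2 : 4 * ((Finset.univ.image P.par).card : ℝ) ≤ 3 * (m : ℝ) ^ 2 := by linarith
    exact_mod_cast h2
  obtain ⟨f, hf, -⟩ := P.exists_cover (m + 1) (Finset.univ.image P.par) ∅ (fun _ => 0)
    (fun _ => P.root) (fun v _ => Finset.mem_image_of_mem _ (Finset.mem_univ v)) (by simp)
    (by simp) (by
      zify at hpot
      push_cast
      simpa using hpot)
  refine Nat.sInf_le ⟨fun i => f (m - i), fun u => ?_⟩
  obtain ⟨r, hr, a, b, hab, he⟩ := hf (P.par u) (Finset.mem_image_of_mem _ (Finset.mem_univ u))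
  refine ⟨⟨m - r, by omega⟩, hG.preconnected _ _, ?_⟩
  have hnear : P.Near (r + 1) (f (m - (m - r))) u :=
    ⟨a, b + 1, by omega, by
      rw [Function.iterate_succ_apply, ← he, show m - (m - r) = r by omega]⟩
  refine (P.dist_le_of_near hG (fun v hv => hle (hP v hv)) hnear).trans ?_
  simp only
  omega
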